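/- arXiv:0711.1668 — 2 statements merged into one kernel-verified Lean document; each statement's English description precedes it below -/
import Mathlib

section
/- Let ℓ ≥ 3 be an integer and let ε be a real number with 0 < ε < sin(π/ℓ). Define two bijections of the Riemann sphere ℂ ∪ {∞}: β(z) = e^(2πi/ℓ)·z for z ∈ ℂ and β(∞) = ∞; and α(z) = 1 + ε²·(z−1)⁻¹ for z ∈ ℂ∖{1}, α(1) = ∞, α(∞) = 1. Then α∘α = id, β iterated ℓ times is id, and the group homomorphism from the free product (ℤ/2) ∗ (ℤ/ℓ) to the group of bijections of ℂ ∪ {∞} determined by sending the generator of ℤ/2 to α and the generator of ℤ/ℓ to β is injective. -/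
open OnePoint Real

lemma two_sin_le_norm (ℓ : ℕ) (hℓ : 3 ≤ ℓ) (k : ℕ) (hk : 0 < k) (hkl : k < ℓ) :
    2 * Real.sin (π / ℓ) ≤ ‖Complex.exp (2 * π * Complex.I / ℓ) ^ k - 1‖ := by
  have hl : (0 : ℝ) < ℓ := by exact_mod_cast (by omega : 0 < ℓ)
  have h1 : Complex.exp (2 * π * Complex.I / ℓ) ^ k
      = Complex.exp (Complex.I * ((2 * (π * k / ℓ) : ℝ) : ℂ)) := by
    rw [← Complex.exp_nat_mul]
    congr 1
    push_cast
    ring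
  rw [h1, Complex.norm_exp_I_mul_ofReal_sub_one, mul_div_cancel_left₀ _ (two_ne_zero), norm_mul]
  rw [Real.norm_eq_abs, Real.norm_eq_abs, abs_of_pos (by norm_num : (0 : ℝ) < 2)]
  refine mul_le_mul_of_nonneg_left (le_trans ?_ (le_abs_self _)) (by norm_num)
  have hl3 : (3 : ℝ) ≤ ℓ := by exact_mod_cast hℓ
  have hp := Real.pi_pos
  have k1 : (1 : ℝ) ≤ k := by exact_mod_cast hk
  have k2 : (k : ℝ) + 1 ≤ ℓ := by exact_mod_cast hkl
  have a0 : 0 < π / ℓ := by positivity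
  have al : π / ℓ * ℓ = π := by field_simp
  have e : π * k / ℓ = π / ℓ * k := by ring
  rw [e]
  generalize π / ℓ = a at *
  have ahalf : a ≤ π / 2 := by nlinarith
  by_cases hc : a * k ≤ π / 2
  · exact Real.sin_le_sin_of_le_of_le_pi_div_two (by linarith) hc (by nlinarith)
  · rw [← Real.sin_pi_sub (a * k)]
    exact Real.sin_le_sin_of_le_of_le_pi_div_two (by linarith) (by linarith) (by nlinarith)

/-- The family of two cyclic groups. -/
abbrev kfam (ℓ : ℕ) (b : Bool) : Type := Multiplicative (ZMod (bif b then 2 else ℓ))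

/-- The homomorphisms from the two factors. -/
def khom {P : Type*} [Monoid P] (ℓ : ℕ)
    (φ : Monoid.Coprod (Multiplicative (ZMod 2)) (Multiplicative (ZMod ℓ)) →* P) :
    ∀ b, kfam ℓ b →* P
  | true => φ.comp Monoid.Coprod.inl
  | false => φ.comp Monoid.Coprod.inr

lemma kinj {P : Type*} [Monoid P] (ℓ : ℕ)
    (φ : Monoid.Coprod (Multiplicative (ZMod 2)) (Multiplicative (ZMod ℓ)) →* P)
    (h : Function.Injective (Monoid.CoprodI.lift (khom ℓ φ))) : Function.Injective φ := by
  let ψ : Monoid.Coprod (Multiplicative (ZMod 2)) (Multiplicative (ZMod ℓ)) →*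
      Monoid.CoprodI (kfam ℓ) :=
    Monoid.Coprod.lift (Monoid.CoprodI.of (M := kfam ℓ) (i := true))
      (Monoid.CoprodI.of (M := kfam ℓ) (i := false))
  have hl : ∀ {Q : Type _} [Monoid Q]
      (χ : Monoid.Coprod (Multiplicative (ZMod 2)) (Multiplicative (ZMod ℓ)) →* Q),
      (Monoid.CoprodI.lift (khom ℓ χ)).comp ψ = χ := by
    intro Q _ χ
    apply Monoid.Coprod.hom_ext
    · refine MonoidHom.ext fun x => ?_
      exact Monoid.CoprodI.lift_of (khom ℓ χ) (i := true) x
    · refine MonoidHom.ext fun x => ?_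
      exact Monoid.CoprodI.lift_of (khom ℓ χ) (i := false) x
  have hψ : Function.Injective ψ := by
    have := hl (MonoidHom.id _)
    exact Function.LeftInverse.injective (g := Monoid.CoprodI.lift (khom ℓ (MonoidHom.id _)))
      (fun x => DFunLike.congr_fun this x)
  have h2 : (Monoid.CoprodI.lift (khom ℓ φ)) ∘ ψ = φ := by
    funext x
    have h3 : (Monoid.CoprodI.lift (khom ℓ φ)).comp ψ = φ := by
      apply Monoid.Coprod.hom_ext
      · refine MonoidHom.ext fun x => ?_
        exact Monoid.CoprodI.lift_of (khom ℓ φ) (i := true) x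
      · refine MonoidHom.ext fun x => ?_
        exact Monoid.CoprodI.lift_of (khom ℓ φ) (i := false) x
    exact DFunLike.congr_fun h3 x
  rw [← h2]
  exact h.comp hψ

open OnePoint Real

/-- The inversion `α(z) = 1 + ε²(z−1)⁻¹` (with `0 < ε < sin(π/ℓ)`) and the rotation
`β(z) = e^(2πi/ℓ) z` of the Riemann sphere `ℂ ∪ {∞}` satisfy `α² = id`, `β^ℓ = id`, and
the homomorphism from `(ℤ/2) ∗ (ℤ/ℓ)` to the bijections of `ℂ ∪ {∞}` determined by
sending the generators to `α` and `β` is injective. -/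
theorem kleinian_free_product_injective
    (ℓ : ℕ) (hℓ : 3 ≤ ℓ) (ε : ℝ) (hε : 0 < ε) (hε' : ε < Real.sin (π / ℓ))
    (α β : OnePoint ℂ → OnePoint ℂ)
    (hβ : ∀ z : ℂ, β (↑z) = ((Complex.exp (2 * π * Complex.I / ℓ) * z : ℂ) : OnePoint ℂ))
    (hbinf : β ∞ = ∞)
    (hα : ∀ z : ℂ, z ≠ 1 → α (↑z) = ((1 + (ε : ℂ) ^ 2 * (z - 1)⁻¹ : ℂ) : OnePoint ℂ))
    (hα1 : α ((1 : ℂ) : OnePoint ℂ) = ∞)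
    (hainf : α ∞ = ((1 : ℂ) : OnePoint ℂ)) :
    (α ∘ α = id) ∧ (β^[ℓ] = id) ∧
      ∀ φ : Monoid.Coprod (Multiplicative (ZMod 2)) (Multiplicative (ZMod ℓ)) →*
          Equiv.Perm (OnePoint ℂ),
        (∀ x, φ (Monoid.Coprod.inl (Multiplicative.ofAdd (1 : ZMod 2))) x = α x) →
        (∀ x, φ (Monoid.Coprod.inr (Multiplicative.ofAdd (1 : ZMod ℓ))) x = β x) →
        Function.Injective φ := by
  have hl0 : (ℓ : ℂ) ≠ 0 := by exact_mod_cast (by omega : ℓ ≠ 0)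
  have hεc : (ε : ℂ) ≠ 0 := by exact_mod_cast hε.ne'
  have hβk : ∀ (k : ℕ) (z : ℂ), β^[k] (↑z) =
      ((Complex.exp (2 * π * Complex.I / ℓ) ^ k * z : ℂ) : OnePoint ℂ) := by
    intro k
    induction k with
    | zero => intro z; simp
    | succ k ih => intro z; rw [Function.iterate_succ_apply', ih, hβ, pow_succ', ← mul_assoc (Complex.exp _)]
  refine ⟨?_, ?_, ?_⟩
  · funext x
    induction x using OnePoint.rec with
    | infty => simp [hainf, hα1]
    | coe z =>
      by_cases hz : z = 1
      · subst hz; simp [hainf, hα1]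
      · have hz' : z - 1 ≠ 0 := sub_ne_zero.mpr hz
        have h2 : (1 + (ε : ℂ) ^ 2 * (z - 1)⁻¹ : ℂ) ≠ 1 := by
          simp [hεc, hz']
        simp only [Function.comp_apply, id]
        rw [hα z hz, hα _ h2]
        congr 1
        field_simp
        ring
  · funext x
    induction x using OnePoint.rec with
    | infty => exact Function.iterate_fixed hbinf ℓ
    | coe z =>
      rw [hβk, ← Complex.exp_nat_mul, mul_div_cancel₀ _ hl0, Complex.exp_two_pi_mul_I]
      simp
  · intro φ hφα hφβ
    apply kinj
    let D : Set (OnePoint ℂ) := (fun z : ℂ => (z : OnePoint ℂ)) '' Metric.closedBall 1 ε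
    refine Monoid.CoprodI.lift_injective_of_ping_pong (khom ℓ φ) (Or.inr ⟨false, ?_⟩)
      (fun b => bif b then D else Dᶜ) ?_ ?_ ?_
    · have : NeZero ℓ := ⟨by omega⟩
      change (3 : Cardinal) ≤ Cardinal.mk (ZMod ℓ)
      rw [Cardinal.mk_fintype, ZMod.card]
      exact_mod_cast hℓ
    · rintro (_ | _)
      · exact ⟨∞, by simp [D]⟩
      · exact ⟨((1 : ℂ) : OnePoint ℂ), 1, by simp [hε.le], rfl⟩
    · rintro (_ | _) (_ | _) h
      · exact absurd rfl h
      · exact disjoint_compl_left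
      · exact disjoint_compl_right
      · exact absurd rfl h
    · rintro (_ | _) (_ | _) hij h hne
      · exact absurd rfl hij
      · -- the rotation factor
        have : NeZero ℓ := ⟨by omega⟩
        change Multiplicative (ZMod ℓ) at h
        rintro _ ⟨_, ⟨z, hz, rfl⟩, rfl⟩
        have hz1 : ‖z - 1‖ ≤ ε := by simpa [dist_eq_norm] using hz
        have hv : h = Multiplicative.ofAdd (1 : ZMod ℓ) ^ (ZMod.val h.toAdd) := by
          apply Multiplicative.toAdd.injective
          rw [toAdd_pow]
          simp
        have hk0 : 0 < ZMod.val h.toAdd := by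
          rw [Nat.pos_iff_ne_zero]
          intro h0
          apply hne
          rw [h0, pow_zero] at hv
          exact hv
        have hkl : ZMod.val h.toAdd < ℓ := ZMod.val_lt _
        generalize ZMod.val h.toAdd = k at *
        have hit : ∀ x, (φ (Monoid.Coprod.inr h)) x = β^[k] x := by
          intro x
          have hb : ⇑(φ (Monoid.Coprod.inr (Multiplicative.ofAdd (1 : ZMod ℓ)))) = β :=
            funext hφβ
          rw [hv, map_pow, map_pow, Equiv.Perm.coe_pow, hb]
        have key : (φ (Monoid.Coprod.inr h)) (z : OnePoint ℂ) ∈ Dᶜ := by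
          rw [hit, hβk]
          rintro ⟨w, hw, hwz⟩
          have hw1 : ‖w - 1‖ ≤ ε := by simpa [dist_eq_norm] using hw
          have hwz' := OnePoint.coe_injective hwz
          have hs := two_sin_le_norm ℓ hℓ k hk0 hkl
          have hn : ‖Complex.exp (2 * π * Complex.I / ℓ) ^ k‖ = 1 := by
            have : (2 * π * Complex.I / ℓ : ℂ) = ((2 * π / ℓ : ℝ) : ℂ) * Complex.I := by
              push_cast; ring
            rw [norm_pow, this, Complex.norm_exp_ofReal_mul_I, one_pow]
          generalize Complex.exp (2 * π * Complex.I / ℓ) ^ k = ζ at *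
          have e : ζ - 1 = (w - 1) - ζ * (z - 1) := by rw [hwz']; ring
          have := norm_sub_le (w - 1) (ζ * (z - 1))
          rw [← e, norm_mul, hn, one_mul] at this
          linarith
        exact key
      · -- the inversion factor
        change Multiplicative (ZMod 2) at h
        have hv : h = Multiplicative.ofAdd (1 : ZMod 2) := by
          have : ∀ g : Multiplicative (ZMod 2), g ≠ 1 → g = Multiplicative.ofAdd 1 := by decide
          exact this h hne
        subst hv
        rintro _ ⟨x, hx, rfl⟩
        change x ∈ Dᶜ at hx
        have key : (φ (Monoid.Coprod.inl (Multiplicative.ofAdd (1 : ZMod 2)))) x ∈ D := by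
          rw [hφα]
          induction x using OnePoint.rec with
          | infty => rw [hainf]; exact ⟨1, by simp [hε.le], rfl⟩
          | coe z =>
            have hz : ε < ‖z - 1‖ := by
              by_contra hcon
              exact hx ⟨z, by simpa [dist_eq_norm] using hcon, rfl⟩
            have hz1 : z ≠ 1 := by
              rintro rfl
              simp at hz
              linarith
            rw [hα z hz1]
            refine ⟨_, ?_, rfl⟩
            simp only [Metric.mem_closedBall, dist_eq_norm, add_sub_cancel_left, norm_mul,
              norm_pow, norm_inv, Complex.norm_real, Real.norm_eq_abs, abs_of_pos hε]
            rw [← div_eq_mul_inv, div_le_iff₀ (by linarith)]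
            nlinarith
        exact key
      · exact absurd rfl hij
end

section
/- Let ℍ denote the real quaternions and let i ∈ ℍ be the imaginary unit with components (0,1,0,0). For all nonzero q, q′ ∈ ℍ, one has q·i·(conj q) = q′·i·(conj q′) if and only if there exist real numbers a, b with a² + b² = 1 such that q′ = q·(a + b·i). -/
open Quaternion

/-- For nonzero quaternions `q, q'`, one has `q·i·q̄ = q'·i·q̄'` iff `q' = q·(a + b·i)`
for some reals `a, b` with `a² + b² = 1`. -/
theorem hopf_map_fibers (i : ℍ[ℝ]) (hi : i = ⟨0, 1, 0, 0⟩)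
    (q q' : ℍ[ℝ]) (hq : q ≠ 0) (hq' : q' ≠ 0) :
    q * i * star q = q' * i * star q' ↔
      ∃ a b : ℝ, a ^ 2 + b ^ 2 = 1 ∧ q' = q * ((a : ℍ[ℝ]) + b • i) := by
  have i0 : i.re = 0 := by rw [hi]
  have i1 : i.imI = 1 := by rw [hi]
  have i2 : i.imJ = 0 := by rw [hi]
  have i3 : i.imK = 0 := by rw [hi]
  clear hi
  have hsq : star q ≠ 0 := by simpa using hq
  constructor
  · intro h
    obtain ⟨u, rfl⟩ : ∃ u, q' = q * u := ⟨q⁻¹ * q', by rw [mul_inv_cancel_left₀ hq]⟩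
    have h1 : i = u * i * star u := by
      have h2 : q * i * star q = q * (u * i * star u) * star q := by
        rw [h, star_mul]; simp only [mul_assoc]
      exact mul_left_cancel₀ hq (mul_right_cancel₀ hsq h2)
    have hni : normSq i = 1 := by rw [Quaternion.normSq_def', i0, i1, i2, i3]; norm_num
    have hn : normSq u * normSq u = 1 := by
      have := congrArg normSq h1
      rw [map_mul, map_mul, Quaternion.normSq_star, hni] at this
      linarith
    have hn0 : 0 ≤ normSq u := Quaternion.normSq_nonneg
    have hn1 : normSq u = 1 := by nlinarith
    rw [Quaternion.normSq_def'] at hn1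
    have h3 := congrArg (fun x : ℍ[ℝ] => x.imI) h1
    simp [i0, i1, i2, i3] at h3
    have hJ : u.imJ = 0 := by nlinarith [sq_nonneg u.imJ, sq_nonneg u.imK]
    have hK : u.imK = 0 := by nlinarith [sq_nonneg u.imJ, sq_nonneg u.imK]
    refine ⟨u.re, u.imI, by rw [hJ, hK] at hn1; linarith, ?_⟩
    congr 1
    ext <;> simp [hJ, hK, i0, i1, i2, i3]
  · rintro ⟨a, b, hab, rfl⟩
    have h1 : ((a : ℍ[ℝ]) + b • i) * i * star ((a : ℍ[ℝ]) + b • i) = i := by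
      ext <;> simp [i0, i1, i2, i3] <;> linarith
    calc q * i * star q
        = q * (((a : ℍ[ℝ]) + b • i) * i * star ((a : ℍ[ℝ]) + b • i)) * star q := by rw [h1]
      _ = _ := by rw [star_mul q]; simp only [mul_assoc]
end
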